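/- Let S be a (2,ω)-divisible Cu-semigroup satisfying (O5), (O6) and (O7), and let e ∈ S be a full element. Then there exists a strongly soft element w ∈ S such that w ≤ e ≤ ∞w, λ(e) = λ(w) for every functional λ ∈ F(S), w is full in the sub-Cu-semigroup S_soft of strongly soft elements, and rc(S,e) = rc(S_soft, w). -/

import Mathlib

open Set

/-- The way-below relation: `x ≪ y` if for every increasing sequence with a
supremum dominating `y`, some term of the sequence dominates `x`. -/
def WayBelow {S : Type*} [Preorder S] (x y : S) : Prop :=
  ∀ z : ℕ → S, Monotone z → ∀ s : S, IsLUB (Set.range z) s → y ≤ s → ∃ m : ℕ, x ≤ z m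

/-- A Cu-semigroup: a positively ordered commutative monoid satisfying (O1)-(O4). -/
class CuSemigroup (S : Type*) extends AddCommMonoid S, PartialOrder S where
  zero_le : ∀ x : S, 0 ≤ x
  add_mono : ∀ {a b c d : S}, a ≤ b → c ≤ d → a + c ≤ b + d
  O1 : ∀ z : ℕ → S, Monotone z → ∃ s : S, IsLUB (Set.range z) s
  O2 : ∀ x : S, ∃ z : ℕ → S, (∀ n, WayBelow (z n) (z (n + 1))) ∧ IsLUB (Set.range z) x
  O3 : ∀ {x' x y' y : S}, WayBelow x' x → WayBelow y' y → WayBelow (x' + y') (x + y)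
  O4 : ∀ (x y : ℕ → S), Monotone x → Monotone y → ∀ sx sy : S,
      IsLUB (Set.range x) sx → IsLUB (Set.range y) sy →
      IsLUB (Set.range fun n => x n + y n) (sx + sy)

variable {S : Type*}

lemma CuSemigroup.nsmul_mono [CuSemigroup S] (x : S) : Monotone fun n : ℕ => n • x := by
  intro n m h
  obtain ⟨k, rfl⟩ := Nat.exists_eq_add_of_le h
  show n • x ≤ (n + k) • x
  rw [add_nsmul]
  calc n • x = n • x + 0 := by rw [add_zero]
    _ ≤ n • x + k • x := CuSemigroup.add_mono le_rfl (CuSemigroup.zero_le _)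

/-- `infty x` is the supremum of the increasing sequence `n • x`, i.e. `∞x`. -/
noncomputable def infty [CuSemigroup S] (x : S) : S :=
  (CuSemigroup.O1 (fun n : ℕ => n • x) (CuSemigroup.nsmul_mono x)).choose

lemma infty_isLUB [CuSemigroup S] (x : S) :
    IsLUB (Set.range fun n : ℕ => n • x) (infty x) :=
  (CuSemigroup.O1 (fun n : ℕ => n • x) (CuSemigroup.nsmul_mono x)).choose_spec

/-- An element is strongly soft if every `x' ≪ x` admits `t` with `x' + t ≪ x`
and `x' ≪ ∞t`. -/
def StronglySoft [CuSemigroup S] (x : S) : Prop :=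
  ∀ x' : S, WayBelow x' x → ∃ t : S, WayBelow (x' + t) x ∧ WayBelow x' (infty t)

def SatisfiesO5 (S : Type*) [CuSemigroup S] : Prop :=
  ∀ x' x y' y z : S, WayBelow x' x → WayBelow y' y → x + y ≤ z →
    ∃ c : S, WayBelow y' c ∧ x' + c ≤ z ∧ z ≤ x + c

def SatisfiesO6 (S : Type*) [CuSemigroup S] : Prop :=
  ∀ x' x y z : S, WayBelow x' x → WayBelow x (y + z) →
    ∃ v w : S, v ≤ x ∧ v ≤ y ∧ w ≤ x ∧ w ≤ z ∧ x' ≤ v + w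

def SatisfiesO7 (S : Type*) [CuSemigroup S] : Prop :=
  ∀ x' x y' y w : S, WayBelow x' x → x ≤ w → WayBelow y' y → y ≤ w →
    ∃ z : S, WayBelow x' z ∧ WayBelow y' z ∧ z ≤ w ∧ z ≤ x + y

def TwoOmegaDivisible (S : Type*) [CuSemigroup S] : Prop :=
  ∀ x' x : S, WayBelow x' x → ∃ y : S, 2 • y ≤ x ∧ x' ≤ infty y

def WeaklyCancellative (S : Type*) [CuSemigroup S] : Prop :=
  ∀ x y z : S, WayBelow (x + z) (y + z) → WayBelow x y

def Separative (S : Type*) [CuSemigroup S] : Prop :=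
  ∀ x y t : S, WayBelow (x + t) (y + t) → WayBelow t (infty x) → WayBelow t (infty y) →
    WayBelow x y

def LeftSoftSeparative (S : Type*) [CuSemigroup S] : Prop :=
  ∀ x y t : S, StronglySoft x → WayBelow (x + t) (y + t) → WayBelow t (infty x) →
    WayBelow t (infty y) → WayBelow x y

def AlmostUnperforated (S : Type*) [CuSemigroup S] : Prop :=
  ∀ x y : S, (∃ n : ℕ, 1 ≤ n ∧ (n + 1) • x ≤ n • y) → x ≤ y

def CountablyBased (S : Type*) [CuSemigroup S] : Prop :=
  ∃ D : Set S, D.Countable ∧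
    ∀ x : S, ∃ z : ℕ → S, Monotone z ∧ (∀ n, z n ∈ D) ∧ IsLUB (Set.range z) x

/-- `Lset x` is the set `L_x = { u' : u' ≪ u ≪ x for some strongly soft u }`. -/
def Lset [CuSemigroup S] (x : S) : Set S :=
  { u' | ∃ u : S, StronglySoft u ∧ WayBelow u' u ∧ WayBelow u x }

/-- A functional on a Cu-semigroup: a monoid morphism to `[0,∞]` preserving order
and suprema of increasing sequences. -/
structure CuFunctional (S : Type*) [CuSemigroup S] where
  toFun : S → ENNReal
  map_zero : toFun 0 = 0
  map_add : ∀ x y : S, toFun (x + y) = toFun x + toFun y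
  mono : ∀ x y : S, x ≤ y → toFun x ≤ toFun y
  map_sup : ∀ z : ℕ → S, Monotone z → ∀ s : S, IsLUB (Set.range z) s →
    toFun s = ⨆ n, toFun (z n)

/-- Predicate version: `f : S → [0,∞]` is a functional on `S`. -/
def IsCuFunctional [CuSemigroup S] (f : S → ENNReal) : Prop :=
  f 0 = 0 ∧ (∀ x y : S, f (x + y) = f x + f y) ∧ (∀ x y : S, x ≤ y → f x ≤ f y) ∧
  (∀ z : ℕ → S, Monotone z → ∀ s : S, IsLUB (Set.range z) s → f s = ⨆ n, f (z n))

/-- Least upper bound of `A` computed within the subset `T`. -/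
def IsLUBIn [CuSemigroup S] (T : Set S) (A : Set S) (s : S) : Prop :=
  s ∈ T ∧ s ∈ upperBounds A ∧ ∀ b ∈ T, b ∈ upperBounds A → s ≤ b

/-- The way-below relation computed within the subset `T`. -/
def WayBelowIn [CuSemigroup S] (T : Set S) (x y : S) : Prop :=
  ∀ z : ℕ → S, Monotone z → (∀ n, z n ∈ T) → ∀ s : S, IsLUBIn T (Set.range z) s → y ≤ s →
    ∃ m : ℕ, x ≤ z m

/-- `T` is a sub-Cu-semigroup of `S`: a submonoid which is itself a Cu-semigroup
for the inherited order, such that the inclusion preserves suprema of increasing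
sequences and the way-below relation. -/
structure IsSubCuSemigroup [CuSemigroup S] (T : Set S) : Prop where
  zero_mem : (0 : S) ∈ T
  add_mem : ∀ {x y : S}, x ∈ T → y ∈ T → x + y ∈ T
  o1 : ∀ z : ℕ → S, Monotone z → (∀ n, z n ∈ T) → ∃ s : S, IsLUBIn T (Set.range z) s
  o2 : ∀ x ∈ T, ∃ z : ℕ → S, (∀ n, z n ∈ T) ∧ (∀ n, WayBelowIn T (z n) (z (n + 1))) ∧
        IsLUBIn T (Set.range z) x
  o3 : ∀ {x' x y' y : S}, x' ∈ T → x ∈ T → y' ∈ T → y ∈ T →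
        WayBelowIn T x' x → WayBelowIn T y' y → WayBelowIn T (x' + y') (x + y)
  o4 : ∀ (x y : ℕ → S), Monotone x → Monotone y → (∀ n, x n ∈ T) → (∀ n, y n ∈ T) →
        ∀ sx sy : S, IsLUBIn T (Set.range x) sx → IsLUBIn T (Set.range y) sy →
        IsLUBIn T (Set.range fun n => x n + y n) (sx + sy)
  incl_sup : ∀ z : ℕ → S, Monotone z → (∀ n, z n ∈ T) → ∀ s : S,
        IsLUBIn T (Set.range z) s → IsLUB (Set.range z) s
  incl_wayBelow : ∀ {x y : S}, x ∈ T → y ∈ T → WayBelowIn T x y → WayBelow x y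

def SatisfiesO5In [CuSemigroup S] (T : Set S) : Prop :=
  ∀ x' x y' y z : S, x' ∈ T → x ∈ T → y' ∈ T → y ∈ T → z ∈ T →
    WayBelowIn T x' x → WayBelowIn T y' y → x + y ≤ z →
    ∃ c ∈ T, WayBelowIn T y' c ∧ x' + c ≤ z ∧ z ≤ x + c

def SatisfiesO6In [CuSemigroup S] (T : Set S) : Prop :=
  ∀ x' x y z : S, x' ∈ T → x ∈ T → y ∈ T → z ∈ T →
    WayBelowIn T x' x → WayBelowIn T x (y + z) →
    ∃ v ∈ T, ∃ w ∈ T, v ≤ x ∧ v ≤ y ∧ w ≤ x ∧ w ≤ z ∧ x' ≤ v + w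

def SatisfiesO7In [CuSemigroup S] (T : Set S) : Prop :=
  ∀ x' x y' y w : S, x' ∈ T → x ∈ T → y' ∈ T → y ∈ T → w ∈ T →
    WayBelowIn T x' x → x ≤ w → WayBelowIn T y' y → y ≤ w →
    ∃ z ∈ T, WayBelowIn T x' z ∧ WayBelowIn T y' z ∧ z ≤ w ∧ z ≤ x + y

/-- `f` is a functional on the sub-Cu-semigroup `T` (values off `T` are irrelevant). -/
def IsFunctionalOn [CuSemigroup S] (T : Set S) (f : S → ENNReal) : Prop :=
  f 0 = 0 ∧
  (∀ x ∈ T, ∀ y ∈ T, f (x + y) = f x + f y) ∧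
  (∀ x ∈ T, ∀ y ∈ T, x ≤ y → f x ≤ f y) ∧
  (∀ z : ℕ → S, Monotone z → (∀ n, z n ∈ T) → ∀ s : S, IsLUBIn T (Set.range z) s →
    f s = ⨆ n, f (z n))

/-- An element is full if `x ≤ ∞e` for every `x`. -/
def IsFull [CuSemigroup S] (e : S) : Prop := ∀ x : S, x ≤ infty e

/-- Condition (R1) for `r`: comparison of `x` with `y` whenever
`λ(x) + r·λ(e) ≤ λ(y)` for all functionals. -/
def SatisfiesR1 (S : Type*) [CuSemigroup S] (e : S) (r : NNReal) : Prop :=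
  ∀ x y : S,
    (∀ lam : CuFunctional S, lam.toFun x + (r : ENNReal) * lam.toFun e ≤ lam.toFun y) → x ≤ y

/-- The radius of comparison of `(S, e)`. -/
noncomputable def rc (S : Type*) [CuSemigroup S] (e : S) : ENNReal :=
  ⨅ r ∈ {r : NNReal | 0 < r ∧ SatisfiesR1 S e r}, (r : ENNReal)

/-- Condition (R1) for the sub-Cu-semigroup `T`. -/
def SatisfiesR1On [CuSemigroup S] (T : Set S) (e : S) (r : NNReal) : Prop :=
  ∀ x ∈ T, ∀ y ∈ T,
    (∀ f : S → ENNReal, IsFunctionalOn T f → f x + (r : ENNReal) * f e ≤ f y) → x ≤ y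

/-- The radius of comparison of `(T, e)` for a sub-Cu-semigroup `T ⊆ S`. -/
noncomputable def rcOn [CuSemigroup S] (T : Set S) (e : S) : ENNReal :=
  ⨅ r ∈ {r : NNReal | 0 < r ∧ SatisfiesR1On T e r}, (r : ENNReal)

/-- `dim S ≤ n` in the sense of covering dimension of Cu-semigroups. -/
def DimLe (S : Type*) [CuSemigroup S] (n : ℕ) : Prop :=
  ∀ (x' x : S) (r : ℕ) (y : Fin r → S), WayBelow x' x → WayBelow x (∑ j, y j) →
    ∃ z : Fin r → Fin (n + 1) → S,
      (∀ j k, WayBelow (z j k) (y j)) ∧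
      WayBelow x' (∑ j, ∑ k, z j k) ∧
      (∀ k, WayBelow (∑ j, z j k) x)

/-- The covering dimension of a Cu-semigroup, in `ℕ ∪ {∞}`. -/
noncomputable def cuDim (S : Type*) [CuSemigroup S] : ℕ∞ :=
  ⨅ n ∈ {n : ℕ | DimLe S n}, (n : ℕ∞)

/-- `dim T ≤ n` for a sub-Cu-semigroup `T ⊆ S`. -/
def DimLeOn [CuSemigroup S] (T : Set S) (n : ℕ) : Prop :=
  ∀ (x' x : S), x' ∈ T → x ∈ T → ∀ (r : ℕ) (y : Fin r → S), (∀ j, y j ∈ T) →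
    WayBelowIn T x' x → WayBelowIn T x (∑ j, y j) →
    ∃ z : Fin r → Fin (n + 1) → S,
      (∀ j k, z j k ∈ T) ∧
      (∀ j k, WayBelowIn T (z j k) (y j)) ∧
      WayBelowIn T x' (∑ j, ∑ k, z j k) ∧
      (∀ k, WayBelowIn T (∑ j, z j k) x)

/-- The covering dimension of a sub-Cu-semigroup `T ⊆ S`. -/
noncomputable def cuDimOn [CuSemigroup S] (T : Set S) : ℕ∞ :=
  ⨅ n ∈ {n : ℕ | DimLeOn T n}, (n : ℕ∞)

namespace CuSemigroup

variable [CuSemigroup S]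

instance : IsOrderedAddMonoid S where
  add_le_add_left _ _ h _ := add_mono h le_rfl

lemma le_add_right' (x y : S) : x ≤ x + y := by
  simpa using add_le_add (le_refl x) (zero_le y)

lemma le_add_left' (x y : S) : x ≤ y + x := by
  simpa using add_le_add (zero_le y) (le_refl x)

lemma nsmul_mono_right {x y : S} (h : x ≤ y) (n : ℕ) : n • x ≤ n • y := nsmul_le_nsmul_right h n

lemma le_of_wayBelow {x y : S} (h : WayBelow x y) : x ≤ y := by
  obtain ⟨m, hm⟩ := h (fun _ => y) monotone_const y (by simp) le_rfl
  exact hm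

lemma wayBelow_of_wayBelow_of_le {x y z : S} (h : WayBelow x y) (h' : y ≤ z) : WayBelow x z :=
  fun u hu s hs hz => h u hu s hs (h'.trans hz)

lemma wayBelow_of_le_of_wayBelow {x y z : S} (h : x ≤ y) (h' : WayBelow y z) : WayBelow x z :=
  fun u hu s hs hz => (h' u hu s hs hz).imp fun _ hm => h.trans hm

lemma zero_wayBelow (x : S) : WayBelow 0 x := fun _ _ _ _ _ => ⟨0, zero_le _⟩

lemma nsmul_wayBelow {x y : S} (h : WayBelow x y) (n : ℕ) : WayBelow (n • x) (n • y) := by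
  induction n with
  | zero => simpa using zero_wayBelow (0 : S)
  | succ n ih => simpa only [succ_nsmul] using O3 ih h

lemma exists_approx (x : S) : ∃ z : ℕ → S, Monotone z ∧ (∀ n, WayBelow (z n) (z (n + 1))) ∧
    (∀ n, WayBelow (z n) x) ∧ IsLUB (range z) x := by
  obtain ⟨z, hz, hx⟩ := O2 x
  exact ⟨z, monotone_nat_of_le_succ fun n => le_of_wayBelow (hz n), hz,
    fun n => wayBelow_of_wayBelow_of_le (hz n) (hx.1 ⟨n + 1, rfl⟩), hx⟩

lemma exists_between_of_two {a b x : S} (ha : WayBelow a x) (hb : WayBelow b x) :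
    ∃ m, WayBelow a m ∧ WayBelow b m ∧ WayBelow m x := by
  obtain ⟨z, hm, hz, hzx, hx⟩ := exists_approx x
  obtain ⟨i, hi⟩ := ha z hm x hx le_rfl
  obtain ⟨j, hj⟩ := hb z hm x hx le_rfl
  exact ⟨z (max i j + 1),
    wayBelow_of_le_of_wayBelow (hi.trans (hm (le_max_left _ _))) (hz _),
    wayBelow_of_le_of_wayBelow (hj.trans (hm (le_max_right _ _))) (hz _), hzx _⟩

lemma exists_wayBelow_between {a x : S} (ha : WayBelow a x) :
    ∃ m, WayBelow a m ∧ WayBelow m x := by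
  obtain ⟨m, h, -, h'⟩ := exists_between_of_two ha ha
  exact ⟨m, h, h'⟩

lemma le_of_forall_wayBelow {x y : S} (h : ∀ x', WayBelow x' x → x' ≤ y) : x ≤ y := by
  obtain ⟨z, -, -, hzx, hx⟩ := exists_approx x
  apply hx.2
  rintro _ ⟨n, rfl⟩
  exact h _ (hzx n)

lemma exists_le_add_of_wayBelow {a x y : S} (h : WayBelow a (x + y)) :
    ∃ x' y', WayBelow x' x ∧ WayBelow y' y ∧ a ≤ x' + y' := by
  obtain ⟨u, hu, -, hux, hx⟩ := exists_approx x
  obtain ⟨v, hv, -, hvy, hy⟩ := exists_approx y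
  obtain ⟨m, hm⟩ := h _ (hu.add hv) _ (O4 u v hu hv x y hx hy) le_rfl
  exact ⟨u m, v m, hux m, hvy m, hm⟩

lemma isLUB_nsmul {z : ℕ → S} (hz : Monotone z) {s : S} (hs : IsLUB (range z) s) (n : ℕ) :
    IsLUB (range fun k => n • z k) (n • s) := by
  induction n with
  | zero => simp
  | succ n ih =>
    simp only [succ_nsmul]
    exact O4 _ _ (fun i j h => nsmul_mono_right (hz h) n) hz _ _ ih hs

lemma nsmul_le_infty (n : ℕ) (x : S) : n • x ≤ infty x := (infty_isLUB x).1 ⟨n, rfl⟩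

lemma le_infty (x : S) : x ≤ infty x := by simpa using nsmul_le_infty 1 x

lemma add_le_infty {a b x : S} (ha : a ≤ infty x) (hb : b ≤ infty x) : a + b ≤ infty x := by
  have h := O4 _ _ (nsmul_mono x) (nsmul_mono x) _ _ (infty_isLUB x) (infty_isLUB x)
  refine (add_le_add ha hb).trans (h.2 ?_)
  rintro _ ⟨n, rfl⟩
  simpa only [← add_nsmul] using nsmul_le_infty (n + n) x

lemma nsmul_le_infty_of_le {a x : S} (ha : a ≤ infty x) (n : ℕ) : n • a ≤ infty x := by
  induction n with
  | zero => simpa using zero_le _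
  | succ n ih => simpa only [succ_nsmul] using add_le_infty ih ha

lemma infty_le_infty {x y : S} (h : x ≤ infty y) : infty x ≤ infty y := by
  apply (infty_isLUB x).2
  rintro _ ⟨n, rfl⟩
  exact nsmul_le_infty_of_le h n

lemma infty_mono {x y : S} (h : x ≤ y) : infty x ≤ infty y := infty_le_infty (h.trans (le_infty y))

lemma exists_wayBelow_nsmul_of_wayBelow_infty {a d : S} (h : WayBelow a (infty d)) :
    ∃ (d' : S) (n : ℕ), WayBelow d' d ∧ a ≤ n • d' := by
  obtain ⟨b, hab, hb⟩ := exists_wayBelow_between h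
  obtain ⟨n, hn⟩ := hb _ (nsmul_mono d) _ (infty_isLUB d) le_rfl
  obtain ⟨z, hz, -, hzd, hd⟩ := exists_approx d
  obtain ⟨m, hm⟩ := hab _ (fun i j h => nsmul_mono_right (hz h) n) _ (isLUB_nsmul hz hd n) hn
  exact ⟨z m, n, hzd m, hm⟩

lemma exists_wayBelow_infty_of_wayBelow_infty {a d : S} (h : WayBelow a (infty d)) :
    ∃ d', WayBelow d' d ∧ WayBelow a (infty d') := by
  obtain ⟨b, hab, hb⟩ := exists_wayBelow_between h
  obtain ⟨d', n, hd, h⟩ := exists_wayBelow_nsmul_of_wayBelow_infty hb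
  exact ⟨d', hd, wayBelow_of_wayBelow_of_le hab (h.trans (nsmul_le_infty n d'))⟩

end CuSemigroup

open CuSemigroup

section Soft

variable [CuSemigroup S]

lemma StronglySoft.add {x y : S} (hx : StronglySoft x) (hy : StronglySoft y) :
    StronglySoft (x + y) := by
  intro a ha
  obtain ⟨x', y', hx', hy', h⟩ := exists_le_add_of_wayBelow ha
  obtain ⟨s, hs, hs'⟩ := hx x' hx'
  obtain ⟨t, ht, ht'⟩ := hy y' hy'
  refine ⟨s + t, wayBelow_of_le_of_wayBelow ?_ (O3 hs ht),
    wayBelow_of_wayBelow_of_le (wayBelow_of_le_of_wayBelow h (O3 hs' ht')) ?_⟩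
  · calc a + (s + t) ≤ x' + y' + (s + t) := by gcongr
      _ = _ := by abel
  · exact add_le_infty (infty_mono (le_add_right' _ _)) (infty_mono (le_add_left' _ _))

lemma StronglySoft.of_isLUB {z : ℕ → S} (hz : Monotone z) (hsoft : ∀ n, StronglySoft (z n))
    {s : S} (hs : IsLUB (range z) s) : StronglySoft s := by
  intro a ha
  obtain ⟨b, hab, hb⟩ := exists_wayBelow_between ha
  obtain ⟨n, hn⟩ := hb z hz s hs le_rfl
  obtain ⟨t, ht, ht'⟩ := hsoft n a (wayBelow_of_wayBelow_of_le hab hn)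
  exact ⟨t, wayBelow_of_wayBelow_of_le ht (hs.1 ⟨n, rfl⟩), ht'⟩

/-- Adding a strongly soft element absorbs any element of the ideal it generates. -/
lemma StronglySoft.add_of_le_infty {y s : S} (hs : StronglySoft s) (hy : y ≤ infty s) :
    StronglySoft (y + s) := by
  intro a ha
  obtain ⟨y', s₁, hy', hs₁, h⟩ := exists_le_add_of_wayBelow ha
  obtain ⟨s₂, n, hs₂, hn⟩ :=
    exists_wayBelow_nsmul_of_wayBelow_infty (wayBelow_of_wayBelow_of_le hy' hy)
  obtain ⟨s', h₁, h₂, hs'⟩ := exists_between_of_two hs₁ hs₂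
  obtain ⟨t, ht, ht'⟩ := hs s' hs'
  refine ⟨t, wayBelow_of_le_of_wayBelow ?_ (O3 hy' ht),
    wayBelow_of_wayBelow_of_le (wayBelow_of_le_of_wayBelow ?_ (nsmul_wayBelow ht' (n + 1)))
      (nsmul_le_infty_of_le le_rfl (n + 1))⟩
  · rw [← add_assoc]
    exact add_le_add (h.trans (add_le_add le_rfl (le_of_wayBelow h₁))) le_rfl
  · rw [succ_nsmul]
    exact h.trans (add_le_add (hn.trans (nsmul_mono_right (le_of_wayBelow h₂) n))
      (le_of_wayBelow h₁))

/-- An increasing sequence in which each term leaves room for the next is strongly soft in the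
limit. -/
lemma StronglySoft.of_isLUB_of_room {z t : ℕ → S} (hroom : ∀ n, z n + t n ≤ z (n + 1))
    (ht : ∀ n, z n ≤ infty (t n)) {s : S} (hs : IsLUB (range z) s) : StronglySoft s := by
  have hz : Monotone z := monotone_nat_of_le_succ fun n => (le_add_right' _ _).trans (hroom n)
  intro a ha
  obtain ⟨b, hab, hb⟩ := exists_wayBelow_between ha
  obtain ⟨n, hn⟩ := hb z hz s hs le_rfl
  obtain ⟨t', ht', h⟩ := exists_wayBelow_infty_of_wayBelow_infty
    (wayBelow_of_wayBelow_of_le hab (hn.trans (ht n)))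
  exact ⟨t', wayBelow_of_wayBelow_of_le (O3 hab ht')
    ((add_le_add hn le_rfl).trans ((hroom n).trans (hs.1 ⟨n + 1, rfl⟩))), h⟩

lemma TwoOmegaDivisible.exists_pow (hdiv : TwoOmegaDivisible S) (k : ℕ) {x' x : S}
    (h : WayBelow x' x) : ∃ y : S, 2 ^ k • y ≤ x ∧ x' ≤ infty y := by
  induction k generalizing x' with
  | zero => exact ⟨x, by simp, (le_of_wayBelow h).trans (le_infty x)⟩
  | succ k ih =>
    obtain ⟨x'', h₁, h₂⟩ := exists_wayBelow_between h
    obtain ⟨y, hy, hy'⟩ := ih h₂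
    obtain ⟨y', n, hyy, hn⟩ :=
      exists_wayBelow_nsmul_of_wayBelow_infty (wayBelow_of_wayBelow_of_le h₁ hy')
    obtain ⟨z, hz, hz'⟩ := hdiv y' y hyy
    refine ⟨z, ?_, hn.trans (nsmul_le_infty_of_le hz' n)⟩
    rw [pow_succ, mul_nsmul']
    exact (nsmul_mono_right hz _).trans hy

lemma TwoOmegaDivisible.exists_of_wayBelow_infty (hdiv : TwoOmegaDivisible S) (N : ℕ) {a d : S}
    (h : WayBelow a (infty d)) : ∃ y : S, N • y ≤ d ∧ a ≤ infty y := by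
  obtain ⟨d', n, hd, hn⟩ := exists_wayBelow_nsmul_of_wayBelow_infty h
  obtain ⟨y, hy, hy'⟩ := hdiv.exists_pow N hd
  exact ⟨y, (nsmul_mono y Nat.lt_two_pow_self.le).trans hy, hn.trans (nsmul_le_infty_of_le hy' n)⟩

/-- `IsRoomIn x q' q d` says that `q' ≪ q` and that the complement `d` of `q` in `x` is full
in the ideal generated by `x`. -/
structure IsRoomIn (x q' q d : S) : Prop where
  wayBelow : WayBelow q' q
  add_le : q + d ≤ x
  full : x ≤ infty d

/-- The approximation `q'` of `x` can be enlarged to one that leaves room above `q'` and that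
dominates a given `x₁ ≪ x` up to the factor `(n + 1) / n`. -/
lemma IsRoomIn.exists_next (hdiv : TwoOmegaDivisible S) (hO5 : SatisfiesO5 S)
    (hO6 : SatisfiesO6 S) (hO7 : SatisfiesO7 S) {x q' q d : S} (h : IsRoomIn x q' q d)
    {x₁ : S} (hx₁ : WayBelow x₁ x) (n : ℕ) :
    ∃ p' p d₁ t : S, IsRoomIn x p' p d₁ ∧ q' + t ≤ p' ∧ q' ≤ infty t ∧
      n • x₁ ≤ (n + 1) • p' := by
  obtain ⟨hq, hqd, hxd⟩ := h
  obtain ⟨r, hqr, hrq⟩ := exists_wayBelow_between hq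
  obtain ⟨x₂, hx₁₂, hx₂⟩ := exists_wayBelow_between hx₁
  obtain ⟨x₃, hx₂₃, hx₃⟩ := exists_wayBelow_between hx₂
  have hrx : WayBelow r x := wayBelow_of_wayBelow_of_le hrq ((le_add_right' q d).trans hqd)
  obtain ⟨a, ha, had⟩ := exists_wayBelow_between
    (wayBelow_of_wayBelow_of_le (O3 hrx hx₃) (add_le_infty hxd hxd))
  obtain ⟨y, hyd, hay⟩ := hdiv.exists_of_wayBelow_infty (n + 2) had
  obtain ⟨y₃, hy₃, hay₃⟩ :=
    exists_wayBelow_infty_of_wayBelow_infty (wayBelow_of_wayBelow_of_le ha hay)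
  obtain ⟨y₂, hy₃₂, hy₂⟩ := exists_wayBelow_between hy₃
  obtain ⟨y₁, hy₂₁, hy₁⟩ := exists_wayBelow_between hy₂
  have hr₃ : r ≤ infty y₃ := (le_add_right' _ _).trans (le_of_wayBelow hay₃)
  have hx₃₃ : x₃ ≤ infty y₃ := (le_add_left' _ _).trans (le_of_wayBelow hay₃)
  have h₃₂ : infty y₃ ≤ infty y₂ := infty_mono (le_of_wayBelow hy₃₂)
  obtain ⟨c, hc, hcx, hxc⟩ := hO5 y₂ y₁ (r + (n + 1) • y₁) (q + (n + 1) • y) x hy₂₁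
    (O3 hrq (nsmul_wayBelow hy₁ (n + 1))) <| by
      calc y₁ + (q + (n + 1) • y) ≤ y + (q + (n + 1) • y) :=
            add_le_add (le_of_wayBelow hy₁) le_rfl
        _ = q + (n + 2) • y := by rw [succ_nsmul y (n + 1)]; abel
        _ ≤ x := (add_le_add le_rfl hyd).trans hqd
  obtain ⟨v, w, hvx, hvy, hwx, hwc, hvw⟩ :=
    hO6 x₂ x₃ y₁ c hx₂₃ (wayBelow_of_wayBelow_of_le hx₃ hxc)
  obtain ⟨v', w', hv', hw', hvw'⟩ :=
    exists_le_add_of_wayBelow (wayBelow_of_wayBelow_of_le hx₁₂ hvw)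
  have hg : r + (n • v + y₂) ≤ c := by
    refine le_trans (add_le_add le_rfl ?_) (le_of_wayBelow hc)
    rw [succ_nsmul]
    exact add_le_add (nsmul_mono_right hvy n) (le_of_wayBelow hy₂₁)
  obtain ⟨p₃, hwp, hgp, hpc, hp⟩ := hO7 w' w (q' + (n • v' + y₃)) (r + (n • v + y₂)) c hw' hwc
    (O3 hqr (O3 (nsmul_wayBelow hv' n) hy₃₂)) hg
  have hpy : p₃ ≤ infty y₂ := hp.trans <| add_le_infty (hwx.trans (hx₃₃.trans h₃₂)) <|
    add_le_infty (hr₃.trans h₃₂) <| add_le_infty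
      (nsmul_le_infty_of_le (hvx.trans (hx₃₃.trans h₃₂)) n) (le_infty _)
  obtain ⟨p₀, hwp₀, hgp₀, hp₀⟩ := exists_between_of_two hwp hgp
  obtain ⟨p₁, hp₀₁, hp₁⟩ := exists_wayBelow_between hp₀
  obtain ⟨p₂, hp₁₂, hp₂⟩ := exists_wayBelow_between hp₁
  obtain ⟨e, he, hpe⟩ :=
    exists_wayBelow_infty_of_wayBelow_infty (wayBelow_of_wayBelow_of_le hp₂ hpy)
  obtain ⟨d₁, hd₁, hpd, hxp⟩ := hO5 p₁ p₂ e y₂ x hp₁₂ he <| by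
    calc p₂ + y₂ ≤ c + y₂ := add_le_add ((le_of_wayBelow hp₂).trans hpc) le_rfl
      _ ≤ x := by rwa [add_comm]
  refine ⟨p₀, p₁, d₁, y₃, ⟨hp₀₁, hpd, hxp.trans (add_le_infty ((le_of_wayBelow hpe).trans
    (infty_mono (le_of_wayBelow hd₁))) (le_infty d₁))⟩, ?_, (le_of_wayBelow hqr).trans hr₃, ?_⟩
  · exact (add_le_add le_rfl (le_add_left' _ _)).trans (le_of_wayBelow hgp₀)
  · calc n • x₁ ≤ n • (v' + w') := nsmul_mono_right hvw' n
      _ = n • w' + n • v' := by rw [nsmul_add, add_comm]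
      _ ≤ n • p₀ + p₀ := add_le_add (nsmul_mono_right (le_of_wayBelow hwp₀) n)
        (((le_add_right' _ y₃).trans (le_add_left' _ q')).trans (le_of_wayBelow hgp₀))
      _ = (n + 1) • p₀ := (succ_nsmul _ _).symm

/-- A strongly soft element `w ≤ x` that has the same rank as `x`: every `x' ≪ x` satisfies
`k x' ≤ (k + 1) w` for all large `k`. -/
structure IsSoftPart (x w : S) : Prop where
  soft : StronglySoft w
  le : w ≤ x
  eventually_le : ∀ x', WayBelow x' x → ∃ K : ℕ, ∀ k ≥ K, k • x' ≤ (k + 1) • w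

lemma exists_isSoftPart (hdiv : TwoOmegaDivisible S) (hO5 : SatisfiesO5 S)
    (hO6 : SatisfiesO6 S) (hO7 : SatisfiesO7 S) (x : S) : ∃ w, IsSoftPart x w := by
  obtain ⟨u, hu, -, hux, hx⟩ := exists_approx x
  have step : ∀ (k : ℕ) (a : {a : S × S × S // IsRoomIn x a.1 a.2.1 a.2.2}),
      ∃ b : {a : S × S × S // IsRoomIn x a.1 a.2.1 a.2.2}, ∃ t : S, a.1.1 + t ≤ b.1.1 ∧
        a.1.1 ≤ infty t ∧ k • u k ≤ (k + 1) • b.1.1 := by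
    rintro k ⟨⟨q', q, d⟩, h⟩
    obtain ⟨p', p, d₁, t, hp, h₁, h₂, h₃⟩ := h.exists_next hdiv hO5 hO6 hO7 (hux k) k
    exact ⟨⟨(p', p, d₁), hp⟩, t, h₁, h₂, h₃⟩
  choose next room hroom hinfty happrox using step
  let a : ℕ → {a : S × S × S // IsRoomIn x a.1 a.2.1 a.2.2} := fun n =>
    Nat.rec ⟨(0, 0, x), ⟨zero_wayBelow 0, by simp, le_infty x⟩⟩ next n
  let z : ℕ → S := fun n => (a n).1.1
  have hz : ∀ n, z n + room n (a n) ≤ z (n + 1) := fun n => hroom n (a n)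
  obtain ⟨w, hw⟩ := O1 z (monotone_nat_of_le_succ fun n => (le_add_right' _ _).trans (hz n))
  refine ⟨w, StronglySoft.of_isLUB_of_room hz (fun n => hinfty n (a n)) hw, hw.2 ?_, ?_⟩
  · rintro _ ⟨n, rfl⟩
    exact ((le_of_wayBelow (a n).2.wayBelow).trans (le_add_right' _ _)).trans (a n).2.add_le
  · intro x' hx'
    obtain ⟨K, hK⟩ := hx' u hu x hx le_rfl
    refine ⟨K, fun k hk => (nsmul_mono_right (hK.trans (hu hk)) k).trans
      ((happrox k (a k)).trans (nsmul_mono_right (hw.1 ⟨k + 1, rfl⟩) (k + 1)))⟩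

namespace IsSoftPart

lemma self {x : S} (hx : StronglySoft x) : IsSoftPart x x :=
  ⟨hx, le_rfl, fun _ h => ⟨0, fun k _ => (nsmul_mono_right (le_of_wayBelow h) k).trans
    (nsmul_mono x k.le_succ)⟩⟩

lemma add {x y v w : S} (hv : IsSoftPart x v) (hw : IsSoftPart y w) :
    IsSoftPart (x + y) (v + w) := by
  refine ⟨hv.soft.add hw.soft, add_le_add hv.le hw.le, fun a ha => ?_⟩
  obtain ⟨x', y', hx', hy', h⟩ := exists_le_add_of_wayBelow ha
  obtain ⟨K, hK⟩ := hv.eventually_le x' hx'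
  obtain ⟨L, hL⟩ := hw.eventually_le y' hy'
  refine ⟨max K L, fun k hk => (nsmul_mono_right h k).trans ?_⟩
  rw [nsmul_add, nsmul_add]
  exact add_le_add (hK k ((le_max_left _ _).trans hk)) (hL k ((le_max_right _ _).trans hk))

lemma full {x w : S} (hw : IsSoftPart x w) : x ≤ infty w := by
  refine le_of_forall_wayBelow fun x' hx' => ?_
  obtain ⟨K, hK⟩ := hw.eventually_le x' hx'
  calc x' ≤ (K + 1) • x' := by rw [succ_nsmul]; exact le_add_left' _ _
    _ ≤ (K + 2) • w := hK _ K.le_succ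
    _ ≤ infty w := nsmul_le_infty _ _

end IsSoftPart

lemma ENNReal.le_of_forall_ge_mul_le {a b : ENNReal} {K : ℕ}
    (h : ∀ k ≥ K, (k : ENNReal) * a ≤ (k + 1 : ℕ) * b) : a ≤ b := by
  rcases eq_or_ne b ⊤ with rfl | hb
  · exact le_top
  refine ENNReal.le_of_forall_pos_le_add fun ε hε _ => ?_
  obtain ⟨m, hm⟩ := ENNReal.exists_nat_gt (ENNReal.div_ne_top hb (ENNReal.coe_ne_zero.2 hε.ne'))
  set k := max (max m K) 1 with hk
  have hk0 : (k : ENNReal) ≠ 0 := by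
    have : 1 ≤ k := le_max_right _ _
    exact_mod_cast (by omega : k ≠ 0)
  have hε0 : (ε : ENNReal) ≠ 0 := by exact_mod_cast hε.ne'
  have hbk : b ≤ k * ε := by
    rw [← ENNReal.div_le_iff hε0 ENNReal.coe_ne_top]
    refine hm.le.trans ?_
    exact_mod_cast (le_max_left m K).trans (le_max_left _ 1)
  have h1 := h k ((le_max_right m K).trans (le_max_left _ 1))
  rw [← ENNReal.mul_le_mul_iff_right hk0 (ENNReal.natCast_ne_top k)]
  refine h1.trans ?_
  push_cast
  rw [add_mul, one_mul, mul_add]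
  gcongr

lemma isLUBIn_soft_of_isLUB {A : Set S} {s : S} (hs : StronglySoft s) (h : IsLUB A s) :
    IsLUBIn {x : S | StronglySoft x} A s :=
  ⟨hs, h.1, fun _ _ hb => h.2 hb⟩

lemma isLUB_of_isLUBIn_soft {z : ℕ → S} (hz : Monotone z) (hsoft : ∀ n, StronglySoft (z n))
    {s : S} (h : IsLUBIn {x : S | StronglySoft x} (range z) s) : IsLUB (range z) s := by
  obtain ⟨s', hs'⟩ := O1 z hz
  have : s = s' := le_antisymm (h.2.2 s' (StronglySoft.of_isLUB hz hsoft hs') hs'.1) (hs'.2 h.2.1)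
  exact this ▸ hs'

lemma CuFunctional.isFunctionalOn_soft (lam : CuFunctional S) :
    IsFunctionalOn {x : S | StronglySoft x} lam.toFun :=
  ⟨lam.map_zero, fun x _ y _ => lam.map_add x y, fun x _ y _ => lam.mono x y,
    fun z hz hsoft s hs => lam.map_sup z hz s (isLUB_of_isLUBIn_soft hz hsoft hs)⟩

lemma CuFunctional.map_nsmul (lam : CuFunctional S) (n : ℕ) (x : S) :
    lam.toFun (n • x) = n * lam.toFun x := by
  induction n with
  | zero => simp [lam.map_zero]
  | succ n ih => rw [succ_nsmul, lam.map_add, ih]; push_cast; ring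

lemma IsSoftPart.functional_eq {x w : S} (hw : IsSoftPart x w) (lam : CuFunctional S) :
    lam.toFun x = lam.toFun w := by
  refine le_antisymm ?_ (lam.mono _ _ hw.le)
  obtain ⟨z, hz, -, hzx, hx⟩ := exists_approx x
  rw [lam.map_sup z hz x hx]
  refine iSup_le fun n => ?_
  obtain ⟨K, hK⟩ := hw.eventually_le _ (hzx n)
  refine ENNReal.le_of_forall_ge_mul_le (K := K) fun k hk => ?_
  rw [← lam.map_nsmul, ← lam.map_nsmul]
  exact lam.mono _ _ (hK k hk)

lemma StronglySoft.exists_soft_between (hsp : ∀ x : S, ∃ w, IsSoftPart x w) {x x' : S}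
    (hx : StronglySoft x) (h : WayBelow x' x) :
    ∃ u, StronglySoft u ∧ x' ≤ u ∧ WayBelow u x := by
  obtain ⟨t, ht, ht'⟩ := hx x' h
  obtain ⟨s, hs⟩ := hsp t
  exact ⟨x' + s, hs.soft.add_of_le_infty ((le_of_wayBelow ht').trans (infty_le_infty hs.full)),
    le_add_right' _ _, wayBelow_of_le_of_wayBelow (add_le_add le_rfl hs.le) ht⟩

lemma StronglySoft.exists_approx_soft (hsp : ∀ x : S, ∃ w, IsSoftPart x w) {x : S}
    (hx : StronglySoft x) :
    ∃ u : ℕ → S, Monotone u ∧ (∀ n, StronglySoft (u n)) ∧ (∀ n, WayBelow (u n) x) ∧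
      IsLUB (range u) x := by
  obtain ⟨z, -, -, hzx, hlub⟩ := exists_approx x
  have step : ∀ (k : ℕ) (a : {a : S // StronglySoft a ∧ WayBelow a x}),
      ∃ b : {a : S // StronglySoft a ∧ WayBelow a x}, a.1 ≤ b.1 ∧ z k ≤ b.1 := by
    rintro k ⟨a, -, ha⟩
    obtain ⟨m, h₁, h₂, hm⟩ := exists_between_of_two ha (hzx k)
    obtain ⟨b, hb, hmb, hbx⟩ := hx.exists_soft_between hsp hm
    exact ⟨⟨b, hb, hbx⟩, (le_of_wayBelow h₁).trans hmb, (le_of_wayBelow h₂).trans hmb⟩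
  choose next hle hz using step
  obtain ⟨b, hb, -, hbx⟩ := hx.exists_soft_between hsp (hzx 0)
  let u : ℕ → {a : S // StronglySoft a ∧ WayBelow a x} := fun n => Nat.rec ⟨b, hb, hbx⟩ next n
  refine ⟨fun n => (u n).1, monotone_nat_of_le_succ fun n => hle n (u n), fun n => (u n).2.1,
    fun n => (u n).2.2, ?_, fun c hc => hlub.2 ?_⟩
  · rintro _ ⟨n, rfl⟩
    exact le_of_wayBelow (u n).2.2
  · rintro _ ⟨n, rfl⟩
    exact (hz n (u n)).trans (hc ⟨n + 1, rfl⟩)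

lemma StronglySoft.nsmul {x : S} (hx : StronglySoft x) (n : ℕ) : StronglySoft (n • x) := by
  induction n with
  | zero =>
    rw [zero_nsmul]
    intro a ha
    exact ⟨0, by simpa using ha, wayBelow_of_wayBelow_of_le ha (zero_le _)⟩
  | succ n ih => rw [succ_nsmul]; exact ih.add hx

lemma IsFunctionalOn.map_nsmul_soft {f : S → ENNReal}
    (hf : IsFunctionalOn {x : S | StronglySoft x} f) {x : S} (hx : StronglySoft x) (n : ℕ) :
    f (n • x) = n * f x := by
  induction n with
  | zero => simp [hf.1]
  | succ n ih => rw [succ_nsmul, hf.2.1 _ (hx.nsmul n) _ hx, ih]; push_cast; ring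

lemma IsFunctionalOn.le_of_forall_wayBelow (hsp : ∀ x : S, ∃ w, IsSoftPart x w)
    {f : S → ENNReal} (hf : IsFunctionalOn {x : S | StronglySoft x} f) {v : S}
    (hv : StronglySoft v) {b : ENNReal}
    (h : ∀ v', StronglySoft v' → WayBelow v' v → f v' ≤ b) : f v ≤ b := by
  obtain ⟨u, hu, hus, huv, hlub⟩ := hv.exists_approx_soft hsp
  rw [hf.2.2.2 u hu hus v (isLUBIn_soft_of_isLUB hv hlub)]
  exact iSup_le fun n => h _ (hus n) (huv n)

lemma IsSoftPart.map_le_of_wayBelow {f : S → ENNReal}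
    (hf : IsFunctionalOn {x : S | StronglySoft x} f) {y w v : S} (hw : IsSoftPart y w)
    (hv : StronglySoft v) (h : WayBelow v y) : f v ≤ f w := by
  obtain ⟨K, hK⟩ := hw.eventually_le v h
  refine ENNReal.le_of_forall_ge_mul_le (K := K) fun k hk => ?_
  rw [← hf.map_nsmul_soft hv, ← hf.map_nsmul_soft hw.soft]
  exact hf.2.2.1 _ (hv.nsmul k) _ (hw.soft.nsmul _) (hK k hk)

lemma IsSoftPart.map_le_of_le (hsp : ∀ x : S, ∃ w, IsSoftPart x w) {f : S → ENNReal}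
    (hf : IsFunctionalOn {x : S | StronglySoft x} f) {y w v : S} (hw : IsSoftPart y w)
    (hv : StronglySoft v) (h : v ≤ y) : f v ≤ f w :=
  hf.le_of_forall_wayBelow hsp hv fun _ hs hvv =>
    hw.map_le_of_wayBelow hf hs (wayBelow_of_wayBelow_of_le hvv h)

/-- Functionals on the soft part extend to the whole Cu-semigroup. -/
lemma IsFunctionalOn.exists_extension (hsp : ∀ x : S, ∃ w, IsSoftPart x w) {f : S → ENNReal}
    (hf : IsFunctionalOn {x : S | StronglySoft x} f) :
    ∃ lam : CuFunctional S, ∀ x, StronglySoft x → lam.toFun x = f x := by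
  choose σ hσ using hsp
  have hsp : ∀ x : S, ∃ w, IsSoftPart x w := fun x => ⟨σ x, hσ x⟩
  have key : ∀ {x w : S}, IsSoftPart x w → f (σ x) = f w := fun hw =>
    le_antisymm (hw.map_le_of_le hsp hf (hσ _).soft (hσ _).le)
      ((hσ _).map_le_of_le hsp hf hw.soft hw.le)
  have hmono : ∀ x y : S, x ≤ y → f (σ x) ≤ f (σ y) := fun x y h =>
    (hσ y).map_le_of_le hsp hf (hσ x).soft ((hσ x).le.trans h)
  refine ⟨⟨fun x => f (σ x), ?_, fun x y => ?_, hmono, fun z hz s hs => le_antisymm ?_ ?_⟩,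
    fun x hx => key (IsSoftPart.self hx)⟩
  · have h0 : StronglySoft (0 : S) := by simpa using (hσ 0).soft.nsmul 0
    exact (key (IsSoftPart.self h0)).trans hf.1
  · exact (key ((hσ x).add (hσ y))).trans (hf.2.1 _ (hσ x).soft _ (hσ y).soft)
  · refine hf.le_of_forall_wayBelow hsp (hσ s).soft fun v hv hvs => ?_
    obtain ⟨b, hvb, hb⟩ := exists_wayBelow_between (wayBelow_of_wayBelow_of_le hvs (hσ s).le)
    obtain ⟨n, hn⟩ := hb z hz s hs le_rfl
    exact ((hσ (z n)).map_le_of_wayBelow hf hv (wayBelow_of_wayBelow_of_le hvb hn)).trans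
      (le_iSup (fun n => f (σ (z n))) n)
  · exact iSup_le fun n => hmono _ _ (hs.1 ⟨n, rfl⟩)

lemma SatisfiesR1.on_soft {e w : S} {r : NNReal} (h : SatisfiesR1 S e r) (hw : IsSoftPart e w) :
    SatisfiesR1On {x : S | StronglySoft x} w r := fun x _ y _ hxy =>
  h x y fun lam => by
    rw [hw.functional_eq]
    exact hxy _ lam.isFunctionalOn_soft

lemma SatisfiesR1On.of_soft_of_lt (hdiv : TwoOmegaDivisible S)
    (hsp : ∀ x : S, ∃ w, IsSoftPart x w) {e w : S} (he : IsFull e) (hw : IsSoftPart e w)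
    {r r' : NNReal} (h : SatisfiesR1On {x : S | StronglySoft x} w r) (hr : r < r') :
    SatisfiesR1 S e r' := by
  intro x y hxy
  obtain ⟨δ, hδ, rfl⟩ : ∃ δ, 0 < δ ∧ r' = r + δ :=
    ⟨r' - r, tsub_pos_of_lt hr, (add_tsub_cancel_of_le hr.le).symm⟩
  refine le_of_forall_wayBelow fun x' hx' => ?_
  obtain ⟨N, hN⟩ := exists_nat_gt δ⁻¹
  obtain ⟨u₀, hu₀, hxu₀⟩ := hdiv.exists_of_wayBelow_infty N
    (wayBelow_of_wayBelow_of_le hx' (he x))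
  obtain ⟨u, hu⟩ := hsp u₀
  obtain ⟨v, hv⟩ := hsp y
  have hsoft : StronglySoft (x' + u) :=
    hu.soft.add_of_le_infty (hxu₀.trans (infty_le_infty hu.full))
  refine (le_add_right' x' u).trans ((h _ hsoft v hv.soft fun f hf => ?_).trans hv.le)
  obtain ⟨lam, hlam⟩ := hf.exists_extension hsp
  have hδN : (1 : ENNReal) ≤ δ * N := by
    have : 1 ≤ δ * N := by
      rw [← mul_inv_cancel₀ hδ.ne']
      gcongr
    exact_mod_cast this
  have hue : lam.toFun u ≤ δ * lam.toFun e := by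
    calc lam.toFun u = 1 * lam.toFun u := (one_mul _).symm
      _ ≤ δ * N * lam.toFun u := by gcongr
      _ = δ * lam.toFun (N • u) := by rw [lam.map_nsmul, mul_assoc]
      _ ≤ δ * lam.toFun e := by
        gcongr
        exact lam.mono _ _ ((nsmul_mono_right hu.le N).trans hu₀)
  rw [← hlam _ hsoft, ← hlam _ hw.soft, ← hlam _ hv.soft, ← hv.functional_eq, lam.map_add,
    ← hw.functional_eq]
  calc lam.toFun x' + lam.toFun u + r * lam.toFun e
      ≤ lam.toFun x + δ * lam.toFun e + r * lam.toFun e := by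
        gcongr
        exact lam.mono _ _ (le_of_wayBelow hx')
    _ = lam.toFun x + ((r + δ : NNReal) : ENNReal) * lam.toFun e := by push_cast; ring
    _ ≤ lam.toFun y := hxy lam

end Soft

/-- In a (2,ω)-divisible Cu-semigroup satisfying (O5)-(O7) with a
full element `e`, there is a strongly soft `w` with `w ≤ e ≤ ∞w`,
`λ(e) = λ(w)` for all functionals, `w` full in the soft part, and
`rc(S,e) = rc(S_soft, w)`. -/
theorem rc_eq_rc_soft {S : Type*} [CuSemigroup S]
    (hdiv : TwoOmegaDivisible S)
    (hO5 : SatisfiesO5 S) (hO6 : SatisfiesO6 S) (hO7 : SatisfiesO7 S)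
    (e : S) (he : IsFull e) :
    ∃ w : S, StronglySoft w ∧ w ≤ e ∧ e ≤ infty w ∧
      (∀ lam : CuFunctional S, lam.toFun e = lam.toFun w) ∧
      (∀ x : S, StronglySoft x → x ≤ infty w) ∧
      rc S e = rcOn {x : S | StronglySoft x} w := by
  have hsp := exists_isSoftPart hdiv hO5 hO6 hO7
  obtain ⟨w, hw⟩ := hsp e
  refine ⟨w, hw.soft, hw.le, hw.full, hw.functional_eq,
    fun x _ => (he x).trans (infty_le_infty hw.full), le_antisymm ?_ ?_⟩
  · refine le_iInf₂ fun r hr => ENNReal.le_of_forall_pos_le_add fun ε hε _ => ?_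
    have h := hr.2.of_soft_of_lt hdiv hsp he hw (lt_add_of_pos_right r hε)
    calc rc S e ≤ ((r + ε : NNReal) : ENNReal) :=
          iInf₂_le (f := fun (r : NNReal) _ => (r : ENNReal)) (r + ε) ⟨add_pos hr.1 hε, h⟩
      _ = r + ε := ENNReal.coe_add r ε
  · exact le_iInf₂ fun r hr =>
      iInf₂_le (f := fun (r : NNReal) _ => (r : ENNReal)) r ⟨hr.1, hr.2.on_soft hw⟩
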